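/- Let T be a finite tree rooted at an internal vertex r, whose leaves are enumerated without repetition as a_0, …, a_{k−1} (k ≥ 3). Assume: (i) for every internal vertex u there exist indices 0 ≤ s ≤ t ≤ k−1 with L^r(u) = {a_j : s ≤ j ≤ t}; (ii) r is adjacent to a_0; (iii) the parent a′ of a_{k−1} has degree 2 in T or a′ = r. Let G be the graph on V(T) whose edge set is E(T) together with the edges a_i a_{(i+1) mod k} for 0 ≤ i ≤ k−1. Then there exists an assignment of an S-shape 𝒮_u to each vertex u ∈ V(G) such that for all distinct u, v ∈ V(G): 𝒮_u and 𝒮_v share a segment of nonzero length if and only if uv ∈ E(G). -/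

import Mathlib

open SimpleGraph Set Function

/-- `u` is an ancestor of `v` with respect to root `r`:
`u` lies on the unique path in `T` from `r` to `v`. -/
def IsAncestor {V : Type*} (T : SimpleGraph V) (r u v : V) : Prop :=
  ∀ p : T.Walk r v, p.IsPath → u ∈ p.support

/-- `u` is the parent of `v` with respect to root `r`. -/
def IsParent {V : Type*} (T : SimpleGraph V) (r u v : V) : Prop :=
  IsAncestor T r u v ∧ u ≠ v ∧ T.Adj u v

/-- `L^r(u)`: the set of leaves of `T` that are descendants of `u`. -/
def LeafSet {V : Type*} (T : SimpleGraph V) [Fintype V] [DecidableRel T.Adj] (r u : V) :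
    Set V :=
  {c | T.degree c = 1 ∧ IsAncestor T r u c}

/-- The leaf `c_{j mod k}` index. -/
def cidx {k : ℕ} (hk : 0 < k) (j : ℕ) : Fin k := ⟨j % k, Nat.mod_lt _ hk⟩

/-- A set `A` of leaves is cyclically consecutive with respect to the enumeration `c`. -/
def CycConsec {V : Type*} {k : ℕ} (hk : 0 < k) (c : Fin k → V) (A : Set V) : Prop :=
  ∃ j m : ℕ, A = {x | ∃ t ≤ m, x = c (cidx hk (j + t))}

/-- The S-shape `𝒮(x₁, x₂, x₃, y₁, y₂) ⊆ ℝ²`. -/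
def SShape (x1 x2 x3 y1 y2 : ℝ) : Set (ℝ × ℝ) :=
  {p | p.1 = x2 ∧ y1 ≤ p.2 ∧ p.2 ≤ y2} ∪ {p | p.2 = y1 ∧ x1 ≤ p.1 ∧ p.1 ≤ x2} ∪
    {p | p.2 = y2 ∧ x2 ≤ p.1 ∧ p.1 ≤ x3}

/-- Two subsets of `ℝ²` share a segment of nonzero length. -/
def SharesSeg (A B : Set (ℝ × ℝ)) : Prop :=
  ∃ p q : ℝ × ℝ, p ≠ q ∧ segment ℝ p q ⊆ A ∩ B

/-- An S-shape is a union of three convex pieces: vertical, lower and upper. -/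
def sPiece (x1 x2 x3 y1 y2 : ℝ) : Fin 3 → Set (ℝ × ℝ)
  | 0 => {p | p.1 = x2 ∧ y1 ≤ p.2 ∧ p.2 ≤ y2}
  | 1 => {p | p.2 = y1 ∧ x1 ≤ p.1 ∧ p.1 ≤ x2}
  | 2 => {p | p.2 = y2 ∧ x2 ≤ p.1 ∧ p.1 ≤ x3}

theorem sShape_eq_iUnion (x1 x2 x3 y1 y2 : ℝ) :
    SShape x1 x2 x3 y1 y2 = ⋃ i, sPiece x1 x2 x3 y1 y2 i := by
  ext p
  simp [SShape, sPiece, Fin.exists_fin_succ, or_assoc]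

theorem convex_vertical (c a b : ℝ) :
    Convex ℝ {p : ℝ × ℝ | p.1 = c ∧ a ≤ p.2 ∧ p.2 ≤ b} := by
  have : {p : ℝ × ℝ | p.1 = c ∧ a ≤ p.2 ∧ p.2 ≤ b} = {c} ×ˢ Set.Icc a b := by
    ext p; simp
  rw [this]
  exact (convex_singleton c).prod (convex_Icc a b)

theorem convex_horizontal (c a b : ℝ) :
    Convex ℝ {p : ℝ × ℝ | p.2 = c ∧ a ≤ p.1 ∧ p.1 ≤ b} := by
  have : {p : ℝ × ℝ | p.2 = c ∧ a ≤ p.1 ∧ p.1 ≤ b} = Set.Icc a b ×ˢ {c} := by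
    ext p; simp [and_comm]
  rw [this]
  exact (convex_Icc a b).prod (convex_singleton c)

theorem convex_sPiece (x1 x2 x3 y1 y2 : ℝ) (i : Fin 3) :
    Convex ℝ (sPiece x1 x2 x3 y1 y2 i) := by
  fin_cases i
  · exact convex_vertical _ _ _
  · exact convex_horizontal _ _ _
  · exact convex_horizontal _ _ _

/-- Two finite unions of convex sets share a segment iff some two of the pieces meet in at least
two points. -/
theorem sharesSeg_iUnion_iff {ι : Type*} [Finite ι] {A B : ι → Set (ℝ × ℝ)}
    (hA : ∀ i, Convex ℝ (A i)) (hB : ∀ i, Convex ℝ (B i)) :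
    SharesSeg (⋃ i, A i) (⋃ i, B i) ↔ ∃ i j, (A i ∩ B j).Nontrivial := by
  constructor
  · rintro ⟨p, q, hpq, hs⟩
    have hmem (t : Set.Icc (0 : ℝ) 1) :
        ∃ z : ι × ι, AffineMap.lineMap p q (t : ℝ) ∈ A z.1 ∩ B z.2 := by
      have ht : AffineMap.lineMap p q (t : ℝ) ∈ segment ℝ p q := by
        rw [segment_eq_image_lineMap]
        exact ⟨t, t.2, rfl⟩
      obtain ⟨h1, h2⟩ := hs ht
      obtain ⟨i, hi⟩ := Set.mem_iUnion.1 h1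
      obtain ⟨j, hj⟩ := Set.mem_iUnion.1 h2
      exact ⟨(i, j), hi, hj⟩
    choose z hz using hmem
    have : Infinite (Set.Icc (0 : ℝ) 1) := (Set.Icc_infinite zero_lt_one).to_subtype
    obtain ⟨s, t, hst, hzst⟩ := Finite.exists_ne_map_eq_of_infinite z
    refine ⟨_, _, _, hz s, _, hzst ▸ hz t, fun h => hst ?_⟩
    exact Subtype.ext (AffineMap.lineMap_injective ℝ hpq h)
  · rintro ⟨i, j, p, hp, q, hq, hpq⟩
    exact ⟨p, q, hpq, fun x hx =>
      ⟨Set.mem_iUnion.2 ⟨i, (hA i).segment_subset hp.1 hq.1 hx⟩,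
        Set.mem_iUnion.2 ⟨j, (hB j).segment_subset hp.2 hq.2 hx⟩⟩⟩

theorem vertical_inter_vertical_nontrivial (c a b c' a' b' : ℝ) :
    ({p : ℝ × ℝ | p.1 = c ∧ a ≤ p.2 ∧ p.2 ≤ b} ∩
        {p : ℝ × ℝ | p.1 = c' ∧ a' ≤ p.2 ∧ p.2 ≤ b'}).Nontrivial ↔
      c = c' ∧ max a a' < min b b' := by
  constructor
  · rintro ⟨p, ⟨⟨h1, h2, h3⟩, h4, h5, h6⟩, q, ⟨⟨g1, g2, g3⟩, g4, g5, g6⟩, hpq⟩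
    refine ⟨h1.symm.trans h4, ?_⟩
    have hne : p.2 ≠ q.2 := fun h => hpq (Prod.ext (h1.trans g1.symm) h)
    rcases lt_or_gt_of_ne hne with h | h
    · exact (max_le h2 h5).trans_lt (h.trans_le (le_min g3 g6))
    · exact (max_le g2 g5).trans_lt (h.trans_le (le_min h3 h6))
  · rintro ⟨rfl, h⟩
    refine ⟨(c, max a a'), ?_, (c, min b b'), ?_, fun e => h.ne (congrArg Prod.snd e)⟩
    · exact ⟨⟨rfl, le_max_left _ _, h.le.trans (min_le_left _ _)⟩,
        rfl, le_max_right _ _, h.le.trans (min_le_right _ _)⟩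
    · exact ⟨⟨rfl, (le_max_left _ _).trans h.le, min_le_left _ _⟩,
        rfl, (le_max_right _ _).trans h.le, min_le_right _ _⟩

theorem horizontal_inter_horizontal_nontrivial (c a b c' a' b' : ℝ) :
    ({p : ℝ × ℝ | p.2 = c ∧ a ≤ p.1 ∧ p.1 ≤ b} ∩
        {p : ℝ × ℝ | p.2 = c' ∧ a' ≤ p.1 ∧ p.1 ≤ b'}).Nontrivial ↔
      c = c' ∧ max a a' < min b b' := by
  rw [← vertical_inter_vertical_nontrivial, ← Set.image_nontrivial Prod.swap_injective,
    Set.image_swap_eq_preimage_swap]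
  rfl

theorem vertical_inter_horizontal_subsingleton (c a b c' a' b' : ℝ) :
    ({p : ℝ × ℝ | p.1 = c ∧ a ≤ p.2 ∧ p.2 ≤ b} ∩
        {p : ℝ × ℝ | p.2 = c' ∧ a' ≤ p.1 ∧ p.1 ≤ b'}).Subsingleton :=
  fun _ hp _ hq => Prod.ext (hp.1.1.trans hq.1.1.symm) (hp.2.1.trans hq.2.1.symm)

/-- S-shapes with integral corners share a segment iff their verticals, or two of their
horizontals, are collinear and overlap. -/
theorem sharesSeg_sShape_intCast_iff (x1 x2 x3 y1 y2 x1' x2' x3' y1' y2' : ℤ) :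
    SharesSeg (SShape x1 x2 x3 y1 y2) (SShape x1' x2' x3' y1' y2') ↔
      (x2 = x2' ∧ max y1 y1' < min y2 y2') ∨
      (y1 = y1' ∧ max x1 x1' < min x2 x2') ∨ (y1 = y2' ∧ max x1 x2' < min x2 x3') ∨
      (y2 = y1' ∧ max x2 x1' < min x3 x2') ∨ (y2 = y2' ∧ max x2 x2' < min x3 x3') := by
  rw [sShape_eq_iUnion, sShape_eq_iUnion,
    sharesSeg_iUnion_iff (convex_sPiece _ _ _ _ _) (convex_sPiece _ _ _ _ _)]
  have key (c a b c' a' b' : ℝ) := Set.not_nontrivial_iff.2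
    (vertical_inter_horizontal_subsingleton c a b c' a' b')
  have key' (c a b c' a' b' : ℝ) := Set.inter_comm _ _ ▸ key c a b c' a' b'
  simp only [Fin.exists_fin_succ, sPiece, Fin.succ_zero_eq_one,
    Fin.succ_one_eq_two, IsEmpty.exists_iff, or_false, key, key', false_or,
    vertical_inter_vertical_nontrivial, horizontal_inter_horizontal_nontrivial, or_assoc]
  norm_cast

/-- The parent function of a rooted finite tree, with an injective ranking of the vertices in
which parents precede their children. -/
theorem SimpleGraph.IsTree.exists_parent_rank {V : Type*} [Finite V] {T : SimpleGraph V}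
    (hT : T.IsTree) (r : V) :
    ∃ (par : V → V) (d : V → ℤ), Function.Injective d ∧ (∀ v, 0 ≤ d v) ∧
      (∀ v, v ≠ r → T.Adj (par v) v ∧ d (par v) < d v) ∧
      ∀ u v, T.Adj u v → (v ≠ r ∧ u = par v) ∨ (u ≠ r ∧ v = par u) := by
  obtain ⟨n, ⟨e⟩⟩ := Finite.exists_equiv_fin V
  choose P hP _ using fun v => hT.existsUnique_path r v
  have hlen (v : V) (hv : v ≠ r) : (P (P v).penultimate).length < (P v).length := by
    have hadj := (P v).adj_penultimate (Walk.not_nil_of_ne hv.symm)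
    have h := hT.isAcyclic.path_concat (hP _) (hP v) hadj ((P v).getVert_mem_support _)
    have h' := congrArg Walk.length h
    rw [Walk.length_concat] at h'
    omega
  have hmem (u v : V) (h : T.Adj u v) (hu : u ∈ (P v).support) :
      v ≠ r ∧ u = (P v).penultimate := by
    refine ⟨?_, hT.isAcyclic.eq_penultimate_of_adj_end (hP v) h.symm hu⟩
    rintro rfl
    have hnil : P v = .nil := (Walk.isPath_iff_nil.1 (hP v)).eq_nil
    rw [hnil, Walk.support_nil, List.mem_singleton] at hu
    exact h.ne hu
  refine ⟨fun v => (P v).penultimate, fun v => ((P v).length * n + (e v : ℕ) : ℕ), ?_,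
    fun v => Int.natCast_nonneg _, fun v hv => ⟨?_, ?_⟩, fun u v h => ?_⟩
  · intro u v h
    have h' : (P u).length * n + (e u : ℕ) = (P v).length * n + (e v : ℕ) := Int.natCast_inj.1 h
    have h2 := congrArg (· % n) h'
    simp only [Nat.mul_add_mod', Nat.mod_eq_of_lt (e _).isLt] at h2
    exact e.injective (Fin.ext h2)
  · exact (P v).adj_penultimate (Walk.not_nil_of_ne hv.symm)
  · have h1 := hlen v hv
    have h2 := (e (P v).penultimate).isLt
    have h3 : ((P (P v).penultimate).length + 1) * n ≤ (P v).length * n :=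
      Nat.mul_le_mul_right n h1
    rw [Nat.add_mul] at h3
    simp only [Nat.cast_lt]
    omega
  · by_cases hu : u ∈ (P v).support
    · exact .inl (hmem u v h hu)
    · exact .inr (hmem v u h.symm
        (hT.isAcyclic.mem_support_of_ne_mem_support_of_adj_of_isPath (hP u) (hP v) h hu))

/-- The parameters of an S-shape with integral corners. -/
structure SCorners where
  x1 : ℤ
  x2 : ℤ
  x3 : ℤ
  y1 : ℤ
  y2 : ℤ

namespace SCorners

/-- The parameters are in the order required of an S-shape. -/
def Valid (A : SCorners) : Prop := A.x1 ≤ A.x2 ∧ A.x2 ≤ A.x3 ∧ A.y1 ≤ A.y2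

/-- The verticals, or two of the horizontals, are collinear and overlap. -/
def Meet (A B : SCorners) : Prop :=
  (A.x2 = B.x2 ∧ max A.y1 B.y1 < min A.y2 B.y2) ∨
  (A.y1 = B.y1 ∧ max A.x1 B.x1 < min A.x2 B.x2) ∨
  (A.y1 = B.y2 ∧ max A.x1 B.x2 < min A.x2 B.x3) ∨
  (A.y2 = B.y1 ∧ max A.x2 B.x1 < min A.x3 B.x2) ∨
  (A.y2 = B.y2 ∧ max A.x2 B.x2 < min A.x3 B.x3)

end SCorners

/-- Leaf `i` has label `i ≥ 0` and internal vertices have negative labels. An internal vertex with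
height `f` and parent height `g` runs along its parent's upper horizontal, rises to height `f` and
then passes under all children. -/
def internalCorners (M f g : ℤ) : SCorners := ⟨f - 1, f, M, g, f⟩

/-- Adjacency in terms of labels, heights and parent heights. -/
def LabelAdj (k i f g i' f' g' : ℤ) : Prop :=
  ((i < 0 ∧ f = g') ∨ (i' < 0 ∧ f' = g)) ∨
  (¬ i < 0 ∧ ¬ i' < 0 ∧ (i' = i + 1 ∨ i = i' + 1 ∨ (i = 0 ∧ i' = k - 1) ∨ (i' = 0 ∧ i = k - 1)))

/-- Shapes for an even number `k` of leaves: consecutive leaves alternately share verticals and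
upper horizontals. -/
def evenCorners (k N i f g : ℤ) : SCorners :=
  if i < 0 then internalCorners (N + 2 * k + 10) f g else
    ⟨N + 1 + 2 * (i / 2), N + 2 + 2 * (i / 2), N + 2 * k + 10, g,
      N + 1 + if i = k - 1 then 0 else (i + 1) / 2⟩

theorem evenCorners_valid {k N i f g : ℤ} (hk : 3 ≤ k) (hik : i < k) (hg : g ≤ N)
    (hi : i < 0 → f ≤ N ∧ g < f) : (evenCorners k N i f g).Valid := by
  unfold evenCorners internalCorners SCorners.Valid
  split_ifs <;> dsimp only <;> omega

theorem evenCorners_meet_iff {k N i f g i' f' g' : ℤ} (hk : 3 ≤ k) (hk2 : k % 2 = 0)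
    (hik : i < k) (hik' : i' < k) (hg : g ≤ N) (hg' : g' ≤ N)
    (hi : i < 0 → f ≤ N ∧ g < f) (hi' : i' < 0 → f' ≤ N ∧ g' < f') (hf : f ≠ f')
    (hii' : ¬ i < 0 → i ≠ i') :
    (evenCorners k N i f g).Meet (evenCorners k N i' f' g') ↔ LabelAdj k i f g i' f' g' := by
  unfold evenCorners internalCorners SCorners.Meet LabelAdj
  simp only [max_lt_iff, lt_min_iff]
  by_cases h0 : i < 0 <;> by_cases h0' : i' < 0 <;>
    simp only [h0, h0', if_true, if_false, true_and, not_true, not_false_iff,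
      false_and, or_false, false_or, true_imp_iff, false_imp_iff] at hi hi' hii' ⊢
  all_goals (try split_ifs) <;> constructor
  all_goals rintro (h | h | h | h | h) <;> omega

/-- Shapes for an odd number `k` of leaves, when the first and the last leaf are siblings: these
two share a lower horizontal. -/
def oddSiblingCorners (k N i f g : ℤ) : SCorners :=
  if i < 0 then internalCorners (N + 2 * k + 10) f g else
  if i = k - 1 then ⟨N + 1, N + 2, N + 2 * k + 10, g, N + 1 + (i + 1) / 2⟩ else
    ⟨if i = 0 then N + 1 else N + 3 + 2 * (i / 2), N + 4 + 2 * (i / 2), N + 2 * k + 10, g,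
      N + 1 + (i + 1) / 2⟩

theorem oddSiblingCorners_valid {k N i f g : ℤ} (hk : 3 ≤ k) (hik : i < k) (hg : g ≤ N)
    (hi : i < 0 → f ≤ N ∧ g < f) : (oddSiblingCorners k N i f g).Valid := by
  unfold oddSiblingCorners internalCorners SCorners.Valid
  split_ifs <;> dsimp only <;> omega

theorem oddSiblingCorners_meet_iff {k N c i f g i' f' g' : ℤ} (hk : 3 ≤ k) (hk2 : k % 2 = 1)
    (hik : i < k) (hik' : i' < k) (hg : g ≤ N) (hg' : g' ≤ N)
    (hi : i < 0 → f ≤ N ∧ g < f) (hi' : i' < 0 → f' ≤ N ∧ g' < f') (hf : f ≠ f')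
    (hii' : ¬ i < 0 → i ≠ i') (hc : i = 0 ∨ i = k - 1 → g = c) (hc' : i' = 0 ∨ i' = k - 1 → g' = c) :
    (oddSiblingCorners k N i f g).Meet (oddSiblingCorners k N i' f' g') ↔
      LabelAdj k i f g i' f' g' := by
  unfold oddSiblingCorners internalCorners SCorners.Meet LabelAdj
  simp only [max_lt_iff, lt_min_iff]
  by_cases h0 : i < 0 <;> by_cases h0' : i' < 0 <;>
    simp only [h0, h0', if_true, if_false, true_and, not_true, not_false_iff,
      false_and, or_false, false_or, true_imp_iff, false_imp_iff] at hi hi' hii' ⊢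
  all_goals (try split_ifs) <;> (try dsimp only) <;> constructor
  all_goals rintro (h | h | h | h | h) <;> omega

/-- Shapes for an odd number `k` of leaves, when the last leaf is the only child of its parent,
whose height `P` exceeds all others: the lower horizontal of the last leaf extends beyond the
upper one of its parent and also meets the upper one of the first leaf. -/
def oddPendantCorners (k N P i f g : ℤ) : SCorners :=
  if i < 0 then internalCorners (P + 5) f g else
  if i = k - 1 then ⟨N, P + 2, P + 5, g, P + 1 + (i + 1) / 2⟩ else
    ⟨N + 1 + 2 * (i / 2), N + 2 + 2 * (i / 2), if i = 0 then P else P + 5, g,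
      if i = 0 then P else P + 1 + (i + 1) / 2⟩

theorem oddPendantCorners_valid {k N P i f g : ℤ} (hk : 3 ≤ k) (hP : N + 2 * k + 10 ≤ P)
    (hik : i < k) (hg : i = k - 1 ∧ g = P ∨ i ≠ k - 1 ∧ g ≤ N)
    (hi : i < 0 → (f = P ∨ f ≤ N) ∧ g < f) : (oddPendantCorners k N P i f g).Valid := by
  unfold oddPendantCorners internalCorners SCorners.Valid
  split_ifs <;> dsimp only <;> omega

set_option maxHeartbeats 2000000 in
theorem oddPendantCorners_meet_iff {k N P i f g i' f' g' : ℤ} (hk : 3 ≤ k) (hk2 : k % 2 = 1)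
    (hP : N + 2 * k + 10 ≤ P) (hik : i < k) (hik' : i' < k)
    (hg : i = k - 1 ∧ g = P ∨ i ≠ k - 1 ∧ g ≤ N)
    (hg' : i' = k - 1 ∧ g' = P ∨ i' ≠ k - 1 ∧ g' ≤ N)
    (hi : i < 0 → (f = P ∨ f ≤ N) ∧ g < f) (hi' : i' < 0 → (f' = P ∨ f' ≤ N) ∧ g' < f')
    (hf : f ≠ f') (hii' : ¬ i < 0 → i ≠ i') :
    (oddPendantCorners k N P i f g).Meet (oddPendantCorners k N P i' f' g') ↔
      LabelAdj k i f g i' f' g' := by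
  unfold oddPendantCorners internalCorners SCorners.Meet LabelAdj
  simp only [max_lt_iff, lt_min_iff]
  by_cases h0 : i < 0 <;> by_cases h0' : i' < 0 <;>
    simp only [h0, h0', if_true, if_false, true_and, not_true, not_false_iff,
      false_and, or_false, false_or, true_imp_iff, false_imp_iff] at hi hi' hii' ⊢
  all_goals (try split_ifs) <;> (try dsimp only) <;> constructor
  all_goals rintro (h | h | h | h | h) <;> omega

theorem eq_cidx_succ_iff {k : ℕ} (hk : 0 < k) (m n : Fin k) :
    n = cidx hk ((m : ℕ) + 1) ↔ (n : ℤ) = m + 1 ∨ (n : ℤ) = 0 ∧ (m : ℤ) = k - 1 := by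
  rw [Fin.ext_iff]
  simp only [cidx]
  have hm := m.isLt
  have hn := n.isLt
  rcases Nat.lt_or_ge ((m : ℕ) + 1) k with h | h
  · rw [Nat.mod_eq_of_lt h]
    omega
  · rw [show (m : ℕ) + 1 = k by omega, Nat.mod_self]
    omega

/-- The label of a leaf is its index, and all other vertices are labelled `-1`. -/
noncomputable def leafLabel {V : Type*} {k : ℕ} (a : Fin k → V) : V → ℤ :=
  Function.extend a (fun i => (i : ℤ)) fun _ => -1

theorem leafLabel_apply {V : Type*} {k : ℕ} {a : Fin k → V} (ha : Function.Injective a)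
    (i : Fin k) : leafLabel a (a i) = i :=
  ha.extend_apply _ _ i

theorem leafLabel_neg_iff {V : Type*} {k : ℕ} {a : Fin k → V} (ha : Function.Injective a)
    (v : V) : leafLabel a v < 0 ↔ ¬ ∃ i, v = a i := by
  by_cases h : ∃ i, v = a i
  · obtain ⟨i, rfl⟩ := h
    rw [leafLabel_apply ha]
    simp
  · have h' : ¬ ∃ i, a i = v := fun ⟨i, hi⟩ => h ⟨i, hi.symm⟩
    simp [leafLabel, Function.extend_apply' _ _ _ h', h]

theorem leafLabel_lt {V : Type*} {k : ℕ} {a : Fin k → V} (ha : Function.Injective a)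
    (v : V) : leafLabel a v < k := by
  by_cases h : ∃ i, v = a i
  · obtain ⟨i, rfl⟩ := h
    rw [leafLabel_apply ha]
    exact_mod_cast i.isLt
  · have := (leafLabel_neg_iff ha v).2 h
    omega

theorem leafLabel_ne {V : Type*} {k : ℕ} {a : Fin k → V} (ha : Function.Injective a)
    {u v : V} (huv : u ≠ v) (hu : ¬ leafLabel a u < 0) : leafLabel a u ≠ leafLabel a v := by
  intro h
  have hv := h ▸ hu
  rw [leafLabel_neg_iff ha, not_not] at hu hv
  obtain ⟨i, rfl⟩ := hu
  obtain ⟨j, rfl⟩ := hv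
  rw [leafLabel_apply ha, leafLabel_apply ha] at h
  exact huv (congrArg a (Fin.ext (by exact_mod_cast h)))

theorem eq_of_leafLabel_eq {V : Type*} {k : ℕ} {a : Fin k → V} (ha : Function.Injective a)
    {v : V} {i : Fin k} (h : leafLabel a v = i) : v = a i := by
  by_contra hv
  exact leafLabel_ne ha (Ne.symm hv) (by rw [leafLabel_apply ha]; simp)
    (by rw [leafLabel_apply ha, h])

theorem leaf_cycle_iff {V : Type*} {k : ℕ} (hk : 0 < k) {a : Fin k → V}
    (ha : Function.Injective a) (u v : V) :
    (∃ i : Fin k, (u = a i ∧ v = a (cidx hk ((i : ℕ) + 1))) ∨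
        (v = a i ∧ u = a (cidx hk ((i : ℕ) + 1)))) ↔
      ¬ leafLabel a u < 0 ∧ ¬ leafLabel a v < 0 ∧
        (leafLabel a v = leafLabel a u + 1 ∨ leafLabel a u = leafLabel a v + 1 ∨
          (leafLabel a u = 0 ∧ leafLabel a v = k - 1) ∨
          (leafLabel a v = 0 ∧ leafLabel a u = k - 1)) := by
  simp only [leafLabel_neg_iff ha, not_not]
  constructor
  · rintro ⟨i, ⟨rfl, rfl⟩ | ⟨rfl, rfl⟩⟩ <;> refine ⟨⟨_, rfl⟩, ⟨_, rfl⟩, ?_⟩ <;>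
      simp only [leafLabel_apply ha] <;> have := (eq_cidx_succ_iff hk i _).1 rfl <;> tauto
  · rintro ⟨⟨m, rfl⟩, ⟨n, rfl⟩, h⟩
    simp only [leafLabel_apply ha] at h
    have hm := eq_cidx_succ_iff hk m n
    have hn := eq_cidx_succ_iff hk n m
    by_cases hc : n = cidx hk ((m : ℕ) + 1)
    · exact ⟨m, .inl ⟨rfl, congrArg a hc⟩⟩
    · exact ⟨n, .inr ⟨rfl, congrArg a (hn.2 (by tauto))⟩⟩

/-- The corners `C` of S-shapes that meet exactly along the edges yield the representation. -/
theorem exists_sShape_of_corners {V : Type*} {E : V → V → Prop} (C : V → SCorners)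
    (hC : ∀ v, (C v).Valid) (hE : ∀ u v, u ≠ v → ((C u).Meet (C v) ↔ E u v)) :
    ∃ x1 x2 x3 y1 y2 : V → ℝ, (∀ u : V, x1 u ≤ x2 u ∧ x2 u ≤ x3 u ∧ y1 u ≤ y2 u) ∧
      ∀ u v : V, u ≠ v →
        (SharesSeg (SShape (x1 u) (x2 u) (x3 u) (y1 u) (y2 u))
            (SShape (x1 v) (x2 v) (x3 v) (y1 v) (y2 v)) ↔ E u v) := by
  refine ⟨fun v => (C v).x1, fun v => (C v).x2, fun v => (C v).x3, fun v => (C v).y1,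
    fun v => (C v).y2, fun u => ?_, fun u v huv => ?_⟩
  · obtain ⟨h1, h2, h3⟩ := hC u
    exact ⟨Int.cast_le.2 h1, Int.cast_le.2 h2, Int.cast_le.2 h3⟩
  · rw [sharesSeg_sShape_intCast_iff, ← hE u v huv]
    rfl

open Classical in
theorem adj_iff_height_eq {V : Type*} {T : SimpleGraph V} {r : V} {par : V → V}
    (hpar : ∀ v, v ≠ r → T.Adj (par v) v)
    (hadj : ∀ u v, T.Adj u v → (v ≠ r ∧ u = par v) ∨ (u ≠ r ∧ v = par u))
    {ι f : V → ℤ} (hι : ∀ v, v ≠ r → ι (par v) < 0) (hf : Function.Injective f)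
    (hf0 : ∀ v, 0 ≤ f v) (u v : V) :
    T.Adj u v ↔ (ι u < 0 ∧ f u = if v = r then -1 else f (par v)) ∨
      (ι v < 0 ∧ f v = if u = r then -1 else f (par u)) := by
  have key (u v : V) (h : f u = if v = r then -1 else f (par v)) : T.Adj u v := by
    split_ifs at h with hv
    · have := hf0 u
      omega
    · rw [hf h]
      exact hpar v hv
  constructor
  · intro h
    rcases hadj u v h with ⟨hv, rfl⟩ | ⟨hu, rfl⟩
    · exact .inl ⟨hι v hv, (if_neg hv).symm⟩
    · exact .inr ⟨hι u hu, (if_neg hu).symm⟩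
  · rintro (⟨-, h⟩ | ⟨-, h⟩)
    · exact key u v h
    · exact (key v u h).symm

/-- Under the stated hypotheses on the tree `T` rooted at `r` with leaves
`a_0, …, a_{k−1}`, the graph `G` obtained from `T` by adding the leaf cycle has a
B₂-EPG representation by S-shapes. -/
theorem stmt19 {V : Type*} [Fintype V] (T : SimpleGraph V) [DecidableRel T.Adj]
    (hT : T.IsTree) {k : ℕ} (hk : 3 ≤ k) (a : Fin k → V)
    (hinj : Function.Injective a)
    (hleaf : ∀ v : V, T.degree v = 1 ↔ ∃ i : Fin k, v = a i)
    (r : V) (hr : 2 ≤ T.degree r)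
    (hconsec : ∀ u : V, 2 ≤ T.degree u → ∃ s t : Fin k, s ≤ t ∧
        LeafSet T r u = {x | ∃ j : Fin k, s ≤ j ∧ j ≤ t ∧ x = a j})
    (hra0 : T.Adj r (a ⟨0, by omega⟩))
    (a' : V) (ha' : IsParent T r a' (a ⟨k - 1, by omega⟩))
    (ha'deg : T.degree a' = 2 ∨ a' = r) :
    ∃ x1 x2 x3 y1 y2 : V → ℝ,
      (∀ u : V, x1 u ≤ x2 u ∧ x2 u ≤ x3 u ∧ y1 u ≤ y2 u) ∧
      ∀ u v : V, u ≠ v →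
        (SharesSeg (SShape (x1 u) (x2 u) (x3 u) (y1 u) (y2 u))
            (SShape (x1 v) (x2 v) (x3 v) (y1 v) (y2 v)) ↔
          (T.Adj u v ∨ ∃ i : Fin k,
            (u = a i ∧ v = a (cidx (by omega) ((i : ℕ) + 1))) ∨
            (v = a i ∧ u = a (cidx (by omega) ((i : ℕ) + 1))))) := by
  classical
  obtain ⟨par, d, hd, hd0, hpar, hadj⟩ := hT.exists_parent_rank r
  obtain ⟨N, hN⟩ : ∃ N : ℤ, ∀ v, d v ≤ N := by
    obtain ⟨N, hN⟩ := (Set.finite_range d).bddAbove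
    exact ⟨N, fun v => hN ⟨v, rfl⟩⟩
  have hN0 : 0 ≤ N := (hd0 r).trans (hN r)
  have hleaf_ne (i : Fin k) : a i ≠ r := by
    intro h
    have := (hleaf (a i)).2 ⟨i, rfl⟩
    rw [h] at this
    omega
  have hleaf_adj (i : Fin k) (w : V) (h : T.Adj w (a i)) : w = par (a i) := by
    obtain ⟨x, -, hx⟩ := degree_eq_one_iff_existsUnique_adj.1 ((hleaf (a i)).2 ⟨i, rfl⟩)
    rw [hx w h.symm, hx _ (hpar _ (hleaf_ne i)).1.symm]
  have hι (v : V) (hv : v ≠ r) : leafLabel a (par v) < 0 := by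
    rw [leafLabel_neg_iff hinj]
    rintro ⟨i, hi⟩
    have h1 := hpar v hv
    rw [hi] at h1
    have h2 := (hpar _ (hleaf_ne i)).2
    rw [← hleaf_adj i v h1.1.symm] at h2
    exact lt_asymm h1.2 h2
  have hk' : (3 : ℤ) ≤ k := by exact_mod_cast hk
  have hlt := leafLabel_lt hinj
  have hne := @leafLabel_ne V k a hinj
  have hedge (f : V → ℤ) (hf : Function.Injective f) (hf0 : ∀ v, 0 ≤ f v) (u v : V) :
      LabelAdj k (leafLabel a u) (f u) (if u = r then -1 else f (par u))
        (leafLabel a v) (f v) (if v = r then -1 else f (par v)) ↔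
      (T.Adj u v ∨ ∃ i : Fin k,
            (u = a i ∧ v = a (cidx (by omega) ((i : ℕ) + 1))) ∨
            (v = a i ∧ u = a (cidx (by omega) ((i : ℕ) + 1)))) := by
    rw [adj_iff_height_eq (fun v hv => (hpar v hv).1) hadj hι hf hf0,
      leaf_cycle_iff (by omega) hinj, LabelAdj]
  have hg (v : V) : (if v = r then -1 else d (par v)) < d v := by
    have := hd0 v
    split_ifs with h
    · omega
    · exact (hpar v h).2
  have hgN (v : V) : (if v = r then -1 else d (par v)) ≤ N := (hg v).le.trans (hN v)
  have hlast : a' = par (a ⟨k - 1, by omega⟩) := hleaf_adj _ _ ha'.2.2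
  have hlast_iff (v : V) : leafLabel a v = k - 1 ↔ v = a ⟨k - 1, by omega⟩ := by
    constructor
    · intro h
      refine eq_of_leafLabel_eq hinj ?_
      push_cast [show 1 ≤ k by omega]
      exact h
    · rintro rfl
      rw [leafLabel_apply hinj]
      push_cast [show 1 ≤ k by omega]
      rfl
  rcases Int.emod_two_eq_zero_or_one k with hk2 | hk2
  · refine exists_sShape_of_corners (fun v => evenCorners k N (leafLabel a v) (d v)
      (if v = r then -1 else d (par v))) (fun v => ?_) fun u v huv => ?_
    · exact evenCorners_valid hk' (hlt v) (hgN v) fun _ => ⟨hN v, hg v⟩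
    · rw [evenCorners_meet_iff hk' hk2 (hlt u) (hlt v) (hgN u) (hgN v) (fun _ => ⟨hN u, hg u⟩)
        (fun _ => ⟨hN v, hg v⟩) (hd.ne huv) (hne huv), hedge d hd hd0]
  by_cases har : a' = r
  · have hc (v : V) (hv : leafLabel a v = 0 ∨ leafLabel a v = k - 1) :
        (if v = r then -1 else d (par v)) = d r := by
      rcases hv with hv | hv
      · have hva : v = a ⟨0, by omega⟩ := eq_of_leafLabel_eq hinj (by rw [hv]; rfl)
        rw [hva, if_neg (hleaf_ne _), ← hleaf_adj _ _ hra0]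
      · rw [(hlast_iff v).1 hv, if_neg (hleaf_ne _), ← hlast, har]
    refine exists_sShape_of_corners (fun v => oddSiblingCorners k N (leafLabel a v) (d v)
      (if v = r then -1 else d (par v))) (fun v => ?_) fun u v huv => ?_
    · exact oddSiblingCorners_valid hk' (hlt v) (hgN v) fun _ => ⟨hN v, hg v⟩
    · rw [oddSiblingCorners_meet_iff hk' hk2 (hlt u) (hlt v) (hgN u) (hgN v)
        (fun _ => ⟨hN u, hg u⟩) (fun _ => ⟨hN v, hg v⟩) (hd.ne huv) (hne huv) (hc u) (hc v),
        hedge d hd hd0]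
  · have hdeg : T.degree a' = 2 := ha'deg.resolve_right har
    have hchild (v : V) (hv : v ≠ r) (hva : par v = a') : v = a ⟨k - 1, by omega⟩ := by
      by_contra hvl
      have h1 := hpar v hv
      have h2 := hpar _ (hleaf_ne ⟨k - 1, by omega⟩)
      have h3 := hpar a' har
      rw [hva] at h1
      rw [← hlast] at h2
      have : 2 < (T.neighborFinset a').card := by
        rw [Finset.two_lt_card_iff]
        refine ⟨v, a ⟨k - 1, by omega⟩, par a', ?_, ?_, ?_, hvl, ?_, ?_⟩
        · simpa using h1.1
        · simpa using h2.1
        · simpa using h3.1.symm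
        · intro h
          rw [← h] at h3
          exact lt_asymm h1.2 h3.2
        · intro h
          rw [← h] at h3
          exact lt_asymm h2.2 h3.2
      rw [card_neighborFinset_eq_degree] at this
      omega
    obtain ⟨P, hP⟩ : ∃ P, P = N + 2 * (k : ℤ) + 10 := ⟨_, rfl⟩
    obtain ⟨f, hfd⟩ : ∃ f : V → ℤ, ∀ v, f v = if v = a' then P else d v := ⟨_, fun _ => rfl⟩
    have hf : Function.Injective f := by
      intro u v h
      rw [hfd, hfd] at h
      have hu := hN u
      have hv := hN v
      split_ifs at h with h1 h2 h2
      · rw [h1, h2]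
      · omega
      · omega
      · exact hd h
    have hf0 (v : V) : 0 ≤ f v := by
      have := hd0 v
      rw [hfd]
      split_ifs <;> omega
    have hfP (v : V) : f v = P ∨ f v ≤ N := by
      rw [hfd]
      split_ifs
      · exact .inl rfl
      · exact .inr (hN v)
    have hgP (v : V) : leafLabel a v = k - 1 ∧ (if v = r then -1 else f (par v)) = P ∨
        leafLabel a v ≠ k - 1 ∧ (if v = r then -1 else f (par v)) ≤ N := by
      by_cases hv : v = a ⟨k - 1, by omega⟩
      · refine .inl ⟨(hlast_iff v).2 hv, ?_⟩
        rw [hv, if_neg (hleaf_ne _), ← hlast, hfd, if_pos rfl]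
      · refine .inr ⟨mt (hlast_iff v).1 hv, ?_⟩
        split_ifs with hvr
        · omega
        · rw [hfd, if_neg fun h => hv (hchild v hvr h)]
          exact hN _
    have hgf (v : V) (hv : leafLabel a v < 0) : (if v = r then -1 else f (par v)) < f v := by
      rcases hgP v with ⟨h, -⟩ | ⟨-, h⟩
      · omega
      · by_cases hva : v = a'
        · refine h.trans_lt ?_
          rw [hfd, if_pos hva]
          omega
        · rw [hfd v, if_neg hva]
          split_ifs at h ⊢ with hvr
          · have := hd0 v
            omega
          · rw [hfd] at h ⊢
            split_ifs at h ⊢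
            · omega
            · exact (hpar v hvr).2
    refine exists_sShape_of_corners (fun v => oddPendantCorners k N P (leafLabel a v) (f v)
      (if v = r then -1 else f (par v))) (fun v => ?_) fun u v huv => ?_
    · exact oddPendantCorners_valid hk' hP.ge (hlt v) (hgP v) fun h => ⟨hfP v, hgf v h⟩
    · rw [oddPendantCorners_meet_iff hk' hk2 hP.ge (hlt u) (hlt v) (hgP u) (hgP v)
        (fun h => ⟨hfP u, hgf u h⟩) (fun h => ⟨hfP v, hgf v h⟩) (hf.ne huv) (hne huv),
        hedge f hf hf0]
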